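/- There do not exist real numbers τ, α, a, b, c, d, e, f satisfying all of: a + b + c = −τ/4; d + e + f = 0; d² = (a + τ/12)², e² = (b + τ/12)², f² = (c + τ/12)²; 2(a² + d²) = α − 8, 2(b² + e²) = α − 8, 2(c² + f²) = α − 8; 2·(4(a+b+c)²) − 15·(8(a²+b²+c²+d²+e²+f²)) = −72τ + 576; a = c; and a ≠ b. -/

import Mathlib

/-- The case `a = c`, `a ≠ b` in the proof of Theorem 1.3 is impossible: no real
numbers satisfy all the Singer–Thorpe, super-Einstein, η-Einstein and (4.10)
relations together with `a = c` and `a ≠ b`. -/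
theorem stmt_12 :
    ¬ ∃ τ α a b c d e f : ℝ,
      a + b + c = -τ / 4 ∧
      d + e + f = 0 ∧
      d ^ 2 = (a + τ / 12) ^ 2 ∧
      e ^ 2 = (b + τ / 12) ^ 2 ∧
      f ^ 2 = (c + τ / 12) ^ 2 ∧
      2 * (a ^ 2 + d ^ 2) = α - 8 ∧
      2 * (b ^ 2 + e ^ 2) = α - 8 ∧
      2 * (c ^ 2 + f ^ 2) = α - 8 ∧
      2 * (4 * (a + b + c) ^ 2)
          - 15 * (8 * (a ^ 2 + b ^ 2 + c ^ 2 + d ^ 2 + e ^ 2 + f ^ 2))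
        = -72 * τ + 576 ∧
      a = c ∧
      a ≠ b := by
  rintro ⟨τ, α, a, b, c, d, e, f, hsum, -, hd, he, hf, had, hbe, -, hnorm, rfl, hab⟩
  obtain rfl : b = -τ / 4 - 2 * a := by linarith
  have hprod : (a - (-τ / 4 - 2 * a)) * (a + τ / 6) = 0 := by
    rw [hd] at had
    rw [he] at hbe
    linear_combination (hbe - had) / 4
  obtain rfl : a = -τ / 6 := by
    rcases mul_eq_zero.mp hprod with h | h
    · exact absurd (sub_eq_zero.mp h) hab
    · linarith
  rw [hd, he, hf] at hnorm
  nlinarith [sq_nonneg (τ - 3)]
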